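/- For every Q ∈ A ⊗ m^⊥ there exist a unique X ∈ A ⊗ n and a unique Q_can ∈ A ⊗ V_f such that Q_can = ∑_{j≥0} (1/j!) (ad X)^j (Q − 1 ⊗ f) + 1 ⊗ f − k ∑_{j≥0} (1/(j+1)!) (ad X)^j (∂̃ X), where both sums are finite because ad X is nilpotent. (Equivalently: e^{ad X}(k∂ + Q − f ⊗ 1) = k∂ + Q_can − f ⊗ 1 in the Lie algebra ℂ∂ ⋉ (A ⊗ L); this is Proposition 3.13, the existence and uniqueness of the canonical gauge of a Lax operator, in the purely even case.) -/

import Mathlib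

open TensorProduct

namespace Gauge12

theorem sum_indep {M : Type*} [AddCommGroup M] [Module ℂ M] (g : M → M) (c : ℕ → ℂ) (y : M)
    (N N' : ℕ) (hN : ∀ y, g^[N] y = 0) (hN' : ∀ y, g^[N'] y = 0) :
    ∑ j ∈ Finset.range N, c j • g^[j] y = ∑ j ∈ Finset.range N', c j • g^[j] y := by
  have key : ∀ N N' : ℕ, N ≤ N' → (∀ y, g^[N] y = 0) →
      ∑ j ∈ Finset.range N, c j • g^[j] y = ∑ j ∈ Finset.range N', c j • g^[j] y := by
    intro N N' hle h0
    refine Finset.sum_subset (Finset.range_mono hle) ?_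
    intro j _ hj
    have hj' : N ≤ j := by simpa using hj
    obtain ⟨i, rfl⟩ := Nat.exists_eq_add_of_le hj'
    rw [Function.iterate_add_apply, h0, smul_zero]
  rcases le_total N N' with hle | hle
  · exact key N N' hle hN
  · exact (key N' N hle hN').symm

section abs
variable {M : Type*} [LieRing M] [Module ℂ M] (F : ℤ → Submodule ℂ M)

theorem iter_mem (hbr : ∀ p q : ℤ, ∀ x ∈ F p, ∀ y ∈ F q, ⁅x, y⁆ ∈ F (p + q))
    {X : M} (hX : X ∈ F 1) {q : ℤ} {z : M} (hz : z ∈ F q) (j : ℕ) :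
    (fun z => ⁅X, z⁆)^[j] z ∈ F (q + j) := by
  induction j with
  | zero => simpa using hz
  | succ j ih =>
    rw [Function.iterate_succ_apply']
    have := hbr _ _ _ hX _ ih
    convert this using 2
    push_cast; ring

theorem iter_sub (X : M) (z w : M) (j : ℕ) :
    (fun z => ⁅X, z⁆)^[j] z - (fun z => ⁅X, z⁆)^[j] w = (fun z => ⁅X, z⁆)^[j] (z - w) := by
  induction j with
  | zero => simp
  | succ j ih =>
    simp only [Function.iterate_succ_apply'] at *
    rw [← ih, lie_sub]

theorem iter_diff (hbr : ∀ p q : ℤ, ∀ x ∈ F p, ∀ y ∈ F q, ⁅x, y⁆ ∈ F (p + q))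
    {X Y : M} (hX : X ∈ F 1) (hY : Y ∈ F 1) {p q : ℤ} (hXY : X - Y ∈ F p)
    {z : M} (hz : z ∈ F q) (j : ℕ) :
    (fun z => ⁅X, z⁆)^[j] z - (fun z => ⁅Y, z⁆)^[j] z ∈ F (q + p + j - 1) := by
  induction j with
  | zero => simp
  | succ j ih =>
    simp only [Function.iterate_succ_apply']
    have h1 := hbr _ _ _ hX _ ih
    have h2 := hbr _ _ _ hXY _ (iter_mem F hbr hY hz j)
    have e1 : (1 + (q + p + j - 1) : ℤ) = q + p + (j + 1 : ℕ) - 1 := by push_cast; ring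
    have e2 : (p + (q + j) : ℤ) = q + p + (j + 1 : ℕ) - 1 := by push_cast; ring
    rw [e1] at h1
    rw [e2] at h2
    have := add_mem h1 h2
    rw [lie_sub, sub_lie] at this
    convert this using 1
    abel

/-- The truncated gauge transformation. -/
noncomputable def Phi (N : ℕ) (Q f : M) (D : M →+ M) (k : ℂ) (X : M) : M :=
  (∑ j ∈ Finset.range N, ((j.factorial : ℂ)⁻¹) • (fun z => ⁅X, z⁆)^[j] (Q - f)) + f
    - k • ∑ j ∈ Finset.range N, (((j + 1).factorial : ℂ)⁻¹) • (fun z => ⁅X, z⁆)^[j] (D X)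

theorem Phi_zero (N : ℕ) (Q f : M) (D : M →+ M) (k : ℂ) :
    Phi (N + 2) Q f D k 0 = Q := by
  have h0 : ∀ j : ℕ, ∀ z : M, (fun z => ⁅(0 : M), z⁆)^[j + 1] z = 0 := by
    intro j z
    rw [Function.iterate_succ_apply']; simp
  have h1 : ∀ j : ℕ, (fun z => ⁅(0 : M), z⁆)^[j] (0 : M) = 0 := by
    intro j
    cases j with
    | zero => simp
    | succ j => exact h0 j 0
  simp only [Phi, map_zero, h1, smul_zero, Finset.sum_const_zero, sub_zero]
  rw [Finset.sum_range_succ']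
  simp only [h0]
  simp

theorem Phi_diff (hanti : ∀ p q : ℤ, p ≤ q → F q ≤ F p)
    (hbr : ∀ p q : ℤ, ∀ x ∈ F p, ∀ y ∈ F q, ⁅x, y⁆ ∈ F (p + q))
    (N : ℕ) (Q f : M) (D : M →+ M) (k : ℂ)
    (hD : ∀ p, ∀ x ∈ F p, D x ∈ F p) (hQ : Q ∈ F (-1)) (hf : f ∈ F (-2))
    {X Y : M} (hX : X ∈ F 1) (hY : Y ∈ F 1) {p : ℤ} (hp : 1 ≤ p) (hXY : X - Y ∈ F p) :
    Phi (N + 2) Q f D k X - Phi (N + 2) Q f D k Y - ⁅f, X - Y⁆ ∈ F (p - 1) := by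
  have hz : Q - f ∈ F (-2) := sub_mem (hanti _ _ (by norm_num) hQ) hf
  have hS1 : (∑ j ∈ Finset.range (N + 2), ((j.factorial : ℂ)⁻¹) • (fun z => ⁅X, z⁆)^[j] (Q - f))
      - (∑ j ∈ Finset.range (N + 2), ((j.factorial : ℂ)⁻¹) • (fun z => ⁅Y, z⁆)^[j] (Q - f))
      - ⁅f, X - Y⁆ ∈ F (p - 1) := by
    rw [← Finset.sum_sub_distrib, Finset.sum_range_succ', Finset.sum_range_succ']
    have e : ∀ s : M, s + (((0 + 1 : ℕ).factorial : ℂ)⁻¹ • (fun z => ⁅X, z⁆)^[0 + 1] (Q - f)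
        - ((0 + 1 : ℕ).factorial : ℂ)⁻¹ • (fun z => ⁅Y, z⁆)^[0 + 1] (Q - f))
        + (((0 : ℕ).factorial : ℂ)⁻¹ • (fun z => ⁅X, z⁆)^[0] (Q - f)
        - ((0 : ℕ).factorial : ℂ)⁻¹ • (fun z => ⁅Y, z⁆)^[0] (Q - f)) - ⁅f, X - Y⁆
        = s + ⁅X - Y, Q⁆ := by
      intro s
      have : ⁅f, X - Y⁆ = -⁅X - Y, f⁆ := by rw [lie_skew]
      rw [this]
      simp only [zero_add, Function.iterate_one, Function.iterate_zero, id, Nat.factorial,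
        Nat.mul_one, Nat.cast_one, inv_one, one_smul, sub_self, add_zero, lie_sub, sub_lie]
      abel
    rw [e]
    refine add_mem (sum_mem fun j _ => ?_) ?_
    · rw [← smul_sub]
      refine Submodule.smul_mem _ _ (hanti _ _ ?_ (iter_diff F hbr hX hY hXY hz _))
      push_cast; omega
    · exact hanti _ _ (by omega) (hbr _ _ _ hXY _ hQ)
  have hS2 : (∑ j ∈ Finset.range (N + 2), (((j + 1).factorial : ℂ)⁻¹) • (fun z => ⁅X, z⁆)^[j] (D X))
      - (∑ j ∈ Finset.range (N + 2), (((j + 1).factorial : ℂ)⁻¹) • (fun z => ⁅Y, z⁆)^[j] (D Y))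
      ∈ F (p - 1) := by
    rw [← Finset.sum_sub_distrib]
    refine sum_mem fun j _ => ?_
    rw [← smul_sub]
    refine Submodule.smul_mem _ _ ?_
    have h1 := iter_diff F hbr hX hY hXY (hD _ _ hX) j
    have h2 := iter_mem F hbr hY (hD _ _ hXY) j
    rw [map_sub, ← iter_sub] at h2
    have := add_mem (hanti (p - 1) _ (by omega) h1) (hanti (p - 1) _ (by omega) h2)
    convert this using 1
    abel
  have := sub_mem hS1 (Submodule.smul_mem _ k hS2)
  convert this using 1
  simp only [Phi, smul_sub]
  abel

theorem main (hanti : ∀ p q : ℤ, p ≤ q → F q ≤ F p)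
    (hbr : ∀ p q : ℤ, ∀ x ∈ F p, ∀ y ∈ F q, ⁅x, y⁆ ∈ F (p + q))
    (b : ℕ) (htop : F (-b) = ⊤) (hbot : F b = ⊥)
    (Q f : M) (D : M →+ M) (k : ℂ)
    (hD : ∀ p, ∀ x ∈ F p, D x ∈ F p) (hQ : Q ∈ F (-1)) (hf : f ∈ F (-2))
    (T : M →+ M) (V : Submodule ℂ M)
    (hT1 : ∀ x ∈ F 1, T ⁅f, x⁆ = x) (hT2 : ∀ v ∈ V, T v = 0)
    (hT3 : ∀ y ∈ F (-1), y - ⁅f, T y⁆ ∈ V)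
    (hT4 : ∀ q, -1 ≤ q → ∀ y ∈ F q, T y ∈ F (q + 2)) :
    ∃! XQ : M × M, XQ.1 ∈ F 1 ∧ XQ.2 ∈ V ∧
      ∃ N : ℕ, (∀ y : M, (fun z => ⁅XQ.1, z⁆)^[N] y = 0) ∧ XQ.2 = Phi N Q f D k XQ.1 := by
  set P : M → M := Phi (2 * b + 2) Q f D k with hP
  have hnil : ∀ X ∈ F 1, ∀ y : M, (fun z => ⁅X, z⁆)^[2 * b + 2] y = 0 := by
    intro X hX y
    have h1 := iter_mem F hbr hX (q := -b) (z := y) (by rw [htop]; trivial) (2 * b + 2)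
    have h2 := hanti b _ (by push_cast; omega) h1
    rw [hbot] at h2
    simpa using h2
  have hdiff : ∀ X ∈ F 1, ∀ Y ∈ F 1, ∀ p : ℤ, 1 ≤ p → X - Y ∈ F p →
      (X - T (P X)) - (Y - T (P Y)) ∈ F (p + 1) := by
    intro X hX Y hY p hp hXY
    have h1 := Phi_diff F hanti hbr (2 * b) Q f D k hD hQ hf hX hY hp hXY
    have h2 := hT4 (p - 1) (by omega) _ h1
    rw [map_sub, map_sub, hT1 _ (sub_mem hX hY)] at h2
    have h3 := neg_mem h2
    rw [show p - 1 + 2 = p + 1 by ring] at h3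
    convert h3 using 1
    abel
  have hPmem : ∀ X ∈ F 1, P X ∈ F (-1) := by
    intro X hX
    have h1 := Phi_diff F hanti hbr (2 * b) Q f D k hD hQ hf hX (zero_mem _) le_rfl
      (by simpa using hX)
    rw [Phi_zero, sub_zero] at h1
    have h2 := hanti (-1) _ (by norm_num) h1
    have h3 := hanti (-1) _ (by norm_num) (hbr _ _ _ hf _ hX)
    have := add_mem (add_mem h2 h3) hQ
    convert this using 1
    rw [hP]; abel
  have hTmem : ∀ X ∈ F 1, T (P X) ∈ F 1 := by
    intro X hX
    simpa using hT4 (-1) le_rfl _ (hPmem X hX)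
  have hV : ∀ X ∈ F 1, P X ∈ V ↔ T (P X) = 0 := by
    intro X hX
    refine ⟨hT2 _, fun h0 => ?_⟩
    have := hT3 _ (hPmem X hX)
    simpa [h0] using this
  -- the iteration
  let S : ℕ → M := fun m => (fun X => X - T (P X))^[m] 0
  have hSs : ∀ m, S (m + 1) = S m - T (P (S m)) := by
    intro m
    simp only [S, Function.iterate_succ_apply']
  have hS1 : ∀ m, S m ∈ F 1 := by
    intro m
    induction m with
    | zero => exact zero_mem _
    | succ m ih =>
      rw [hSs]
      exact sub_mem ih (hTmem _ ih)
  have hS2 : ∀ m : ℕ, S (m + 1) - S m ∈ F (m + 1) := by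
    intro m
    induction m with
    | zero => simpa using sub_mem (hS1 1) (hS1 0)
    | succ m ih =>
      have := hdiff _ (hS1 (m + 1)) _ (hS1 m) _ (by omega) ih
      rw [← hSs, ← hSs] at this
      push_cast
      exact this
  have hfix : T (P (S b)) = 0 := by
    have h1 := hanti b _ (by omega) (hS2 b)
    rw [hbot, hSs] at h1
    simpa using h1
  refine ⟨(S b, P (S b)), ⟨hS1 b, (hV _ (hS1 b)).2 hfix, 2 * b + 2, hnil _ (hS1 b), rfl⟩, ?_⟩
  rintro ⟨X, R⟩ ⟨hX, hR, N, hN, hE⟩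
  simp only at hX hR hN hE
  have hE' : R = P X := by
    rw [hE, hP]
    simp only [Phi]
    rw [sum_indep _ (fun j => ((j.factorial : ℂ)⁻¹)) _ N (2 * b + 2) hN (hnil X hX),
      sum_indep _ (fun j => (((j + 1).factorial : ℂ)⁻¹)) _ N (2 * b + 2) hN (hnil X hX)]
  have hXfix : T (P X) = 0 := (hV X hX).1 (hE' ▸ hR)
  have hall : ∀ m : ℕ, X - S b ∈ F (m + 1) := by
    intro m
    induction m with
    | zero => simpa using sub_mem hX (hS1 b)
    | succ m ih =>
      have := hdiff _ hX _ (hS1 b) _ (by omega) ih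
      rw [hXfix, hfix, sub_zero, sub_zero] at this
      push_cast
      exact this
  have hXS : X = S b := by
    have h1 := hanti b _ (by omega) (hall b)
    rw [hbot] at h1
    simpa [sub_eq_zero] using h1
  rw [hE', hXS]

end abs

section bc
variable {L : Type*} [AddCommGroup L] [Module ℂ L] {A : Type*} [CommRing A] [Algebra ℂ A]

theorem bc_induction (p : Submodule ℂ L) (S : AddSubmonoid (A ⊗[ℂ] L))
    (hS : ∀ a : A, ∀ x ∈ p, a ⊗ₜ[ℂ] x ∈ S) {y : A ⊗[ℂ] L} (hy : y ∈ p.baseChange A) : y ∈ S := by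
  rw [Submodule.baseChange_eq_span] at hy
  induction hy using Submodule.closure_induction with
  | zero => exact zero_mem _
  | add x y _ _ hx hy => exact add_mem hx hy
  | smul_mem r x hx =>
    obtain ⟨x, hx, rfl⟩ := hx
    simpa [TensorProduct.smul_tmul'] using hS r x hx

end bc

section gr
variable {L : Type*} [LieRing L] [LieAlgebra ℂ L]

theorem mem_of_eig (h : L) (Lg : ℤ → Submodule ℂ L)
    (hLg : ∀ j : ℤ, ∀ x ∈ Lg j, ⁅h, x⁆ = (j : ℂ) • x)
    (hinternal : DirectSum.IsInternal Lg) (j : ℤ) (y : L) (hy : ⁅h, y⁆ = (j : ℂ) • y) :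
    y ∈ Lg j := by
  classical
  obtain ⟨d, rfl⟩ := hinternal.surjective y
  have h1 : ∀ d : DirectSum ℤ (fun i => Lg i), ⁅h, DirectSum.coeAddMonoidHom Lg d⁆ =
      DirectSum.coeAddMonoidHom Lg (DirectSum.map
        (fun i => (DistribSMul.toAddMonoidHom (Lg i) (i : ℂ))) d) := by
    intro d
    induction d using DirectSum.induction_on with
    | zero => simp
    | of i x =>
      simp [hLg i x x.2]
    | add x y hx hy => rw [map_add, lie_add, hx, hy, map_add, map_add]
  have h2 : ∀ d : DirectSum ℤ (fun i => Lg i), (j : ℂ) • DirectSum.coeAddMonoidHom Lg d =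
      DirectSum.coeAddMonoidHom Lg (DirectSum.map
        (fun i => (DistribSMul.toAddMonoidHom (Lg i) (j : ℂ))) d) := by
    intro d
    induction d using DirectSum.induction_on with
    | zero => simp
    | of i x => simp
    | add x y hx hy => rw [map_add, smul_add, hx, hy, map_add, map_add]
  rw [h1, h2] at hy
  have h3 := hinternal.injective hy
  have h4 : ∀ i, i ≠ j → d i = 0 := by
    intro i hij
    have h33 := DFunLike.congr_fun h3 i
    rw [DirectSum.map_apply, DirectSum.map_apply] at h33
    have this : (i : ℂ) • d i = (j : ℂ) • d i := h33
    rw [← sub_eq_zero, ← sub_smul, smul_eq_zero] at this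
    rcases this with h | h
    · exact absurd (by exact_mod_cast sub_eq_zero.1 h) hij
    · exact h
  have h5 : d = DirectSum.of (fun i => Lg i) j (d j) := by
    ext i
    by_cases hij : i = j
    · subst hij; simp
    · rw [h4 i hij, DirectSum.of_eq_of_ne _ _ _ hij]
  rw [h5]
  simp

end gr

section bridge
variable {L : Type*} [LieRing L] [LieAlgebra ℂ L] {A : Type*} [CommRing A] [Algebra ℂ A]

/-- Left bracket as an additive map. -/
def brL (z : A ⊗[ℂ] L) : (A ⊗[ℂ] L) →+ (A ⊗[ℂ] L) :=
  AddMonoidHom.mk' (fun y => ⁅z, y⁆) (fun c d => lie_add z c d)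

/-- Right bracket as an additive map. -/
def brR (z : A ⊗[ℂ] L) : (A ⊗[ℂ] L) →+ (A ⊗[ℂ] L) :=
  AddMonoidHom.mk' (fun y => ⁅y, z⁆) (fun c d => add_lie c d z)

theorem brL_apply (z y : A ⊗[ℂ] L) : brL z y = ⁅z, y⁆ := rfl
theorem brR_apply (z y : A ⊗[ℂ] L) : brR z y = ⁅y, z⁆ := rfl

theorem bridge (G : ℤ → Submodule ℂ L) (hGanti : ∀ p q : ℤ, p ≤ q → G q ≤ G p)
    (hGbr : ∀ p q : ℤ, ∀ x ∈ G p, ∀ y ∈ G q, ⁅x, y⁆ ∈ G (p + q))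
    (b : ℕ) (hGtop : G (-b) = ⊤) (hGbot : G b = ⊥) (f : L) (hf : f ∈ G (-2))
    (T : L →ₗ[ℂ] L) (Vf : Submodule ℂ L)
    (hTU : ∀ x ∈ G 1, ∀ v ∈ Vf, T (⁅f, x⁆ + v) = x)
    (hdec : ∀ y ∈ G (-1), ∃ x ∈ G 1, ∃ v ∈ Vf, ⁅f, x⁆ + v = y)
    (hTG : ∀ q : ℤ, -1 ≤ q → ∀ y ∈ G q, T y ∈ G (q + 2))
    (Dr : Derivation ℂ A A) (k : ℂ) (Q : A ⊗[ℂ] L) (hQ : Q ∈ (G (-1)).baseChange A) :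
    ∃! XQ : (A ⊗[ℂ] L) × (A ⊗[ℂ] L),
        XQ.1 ∈ Submodule.baseChange A (G 1) ∧
        XQ.2 ∈ Submodule.baseChange A Vf ∧
        ∃ N : ℕ, (∀ y : A ⊗[ℂ] L, (fun z => ⁅XQ.1, z⁆)^[N] y = 0) ∧
          XQ.2 = (∑ j ∈ Finset.range N, ((j.factorial : ℂ)⁻¹) •
                    (fun z => ⁅XQ.1, z⁆)^[j] (Q - (1 : A) ⊗ₜ[ℂ] f))
                 + (1 : A) ⊗ₜ[ℂ] f
                 - k • ∑ j ∈ Finset.range N, (((j + 1).factorial : ℂ)⁻¹) •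
                    (fun z => ⁅XQ.1, z⁆)^[j]
                      ((LinearMap.rTensor L Dr.toLinearMap) XQ.1) := by
  have htm : ∀ (p : Submodule ℂ L) (a : A) (x : L), x ∈ p → a ⊗ₜ[ℂ] x ∈ p.baseChange A :=
    fun p a x hx => Submodule.tmul_mem_baseChange_of_mem a hx
  let F : ℤ → Submodule ℂ (A ⊗[ℂ] L) := fun p => ((G p).baseChange A).restrictScalars ℂ
  have hF : ∀ p y, y ∈ F p ↔ y ∈ (G p).baseChange A := fun p y => Iff.rfl
  let V : Submodule ℂ (A ⊗[ℂ] L) := (Vf.baseChange A).restrictScalars ℂ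
  have hV : ∀ y, y ∈ V ↔ y ∈ Vf.baseChange A := fun y => Iff.rfl
  have htF : ∀ p (a : A) (x : L), x ∈ G p → a ⊗ₜ[ℂ] x ∈ F p := fun p a x hx => htm _ a x hx
  have hFtop : F (-b) = ⊤ := by
    ext y; rw [hF, hGtop, Submodule.baseChange_top]; simp
  have hFbot : F b = ⊥ := by
    ext y; rw [hF, hGbot, Submodule.baseChange_bot]; simp
  clear_value F V
  have hind : ∀ p (S : AddSubmonoid (A ⊗[ℂ] L)), (∀ a : A, ∀ x ∈ G p, a ⊗ₜ[ℂ] x ∈ S) →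
      ∀ y ∈ F p, y ∈ S := fun p S hS y hy => bc_induction (G p) S hS ((hF p y).1 hy)
  have hanti : ∀ p q : ℤ, p ≤ q → F q ≤ F p := by
    intro p q hpq y hy
    exact hind q (F p).toAddSubmonoid (fun a x hx => htF p a x (hGanti p q hpq hx)) y hy
  have hbr : ∀ p q : ℤ, ∀ x ∈ F p, ∀ y ∈ F q, ⁅x, y⁆ ∈ F (p + q) := by
    intro p q x hx y hy
    refine hind p ((F (p + q)).toAddSubmonoid.comap (brR y)) ?_ x hx
    intro a x hx
    refine hind q ((F (p + q)).toAddSubmonoid.comap (brL (a ⊗ₜ[ℂ] x))) ?_ y hy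
    intro c y hy
    rw [AddSubmonoid.mem_comap, brL_apply, LieAlgebra.ExtendScalars.bracket_tmul]
    exact htF _ (a * c) _ (hGbr p q x hx y hy)
  let D : (A ⊗[ℂ] L) →+ (A ⊗[ℂ] L) := (LinearMap.rTensor L Dr.toLinearMap).toAddMonoidHom
  have hDa : ∀ y, D y = LinearMap.rTensor L Dr.toLinearMap y := fun y => rfl
  let T' : (A ⊗[ℂ] L) →+ (A ⊗[ℂ] L) := (T.baseChange A).toAddMonoidHom
  have hT' : ∀ (a : A) (x : L), T' (a ⊗ₜ[ℂ] x) = a ⊗ₜ[ℂ] T x := fun a x => rfl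
  clear_value D T'
  have hD : ∀ p, ∀ x ∈ F p, D x ∈ F p := by
    intro p x hx
    refine hind p ((F p).toAddSubmonoid.comap D) ?_ x hx
    intro a x hx
    rw [AddSubmonoid.mem_comap, hDa, LinearMap.rTensor_tmul]
    exact htF _ _ x hx
  have hT1 : ∀ x ∈ F 1, T' ⁅(1 : A) ⊗ₜ[ℂ] f, x⁆ = x := by
    intro x hx
    refine hind 1 (AddMonoidHom.eqLocusM (T'.comp (brL ((1 : A) ⊗ₜ[ℂ] f)))
        (AddMonoidHom.id _)) ?_ x hx
    intro a x hx
    change T' (brL ((1 : A) ⊗ₜ[ℂ] f) (a ⊗ₜ[ℂ] x)) = a ⊗ₜ[ℂ] x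
    have := hTU x hx 0 (zero_mem _)
    rw [add_zero] at this
    rw [brL_apply, LieAlgebra.ExtendScalars.bracket_tmul, hT', this, one_mul]
  have hT2 : ∀ v ∈ V, T' v = 0 := by
    intro x hx
    refine bc_induction Vf (AddMonoidHom.eqLocusM T' 0) ?_ ((hV x).1 hx)
    intro a v hv
    change T' (a ⊗ₜ[ℂ] v) = 0
    have := hTU 0 (zero_mem _) v hv
    rw [lie_zero, zero_add] at this
    rw [hT', this, tmul_zero]
  have hT3 : ∀ y ∈ F (-1), y - ⁅(1 : A) ⊗ₜ[ℂ] f, T' y⁆ ∈ V := by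
    intro y hy
    refine hind (-1) (V.toAddSubmonoid.comap
        (AddMonoidHom.id _ - (brL ((1 : A) ⊗ₜ[ℂ] f)).comp T')) ?_ y hy
    intro a y hy
    obtain ⟨x, hx, v, hv, rfl⟩ := hdec y hy
    change a ⊗ₜ[ℂ] (⁅f, x⁆ + v) - brL ((1 : A) ⊗ₜ[ℂ] f) (T' (a ⊗ₜ[ℂ] (⁅f, x⁆ + v))) ∈ V
    rw [hT', hTU x hx v hv, brL_apply, LieAlgebra.ExtendScalars.bracket_tmul, one_mul,
      ← tmul_sub, add_sub_cancel_left, hV]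
    exact htm _ _ _ hv
  have hT4 : ∀ q, -1 ≤ q → ∀ y ∈ F q, T' y ∈ F (q + 2) := by
    intro q hq y hy
    refine hind q ((F (q + 2)).toAddSubmonoid.comap T') ?_ y hy
    intro a x hx
    rw [AddSubmonoid.mem_comap, hT']
    exact htF _ a _ (hTG q hq x hx)
  have key := main F hanti hbr b hFtop hFbot Q ((1 : A) ⊗ₜ[ℂ] f) D k hD ((hF _ _).2 hQ)
    (htF _ _ _ hf) T' V hT1 hT2 hT3 hT4
  simp only [hF, hV, Phi, hDa] at key
  exact key

end bridge

end Gauge12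

/-- Proposition 3.13 (purely even case): existence and uniqueness of the canonical
gauge of a Lax operator.  For every `Q ∈ A ⊗ m^⊥` there are a unique `X ∈ A ⊗ n` and a
unique `Q_can ∈ A ⊗ V_f` with
`Q_can = ∑_{j} (1/j!) (ad X)^j (Q − 1⊗f) + 1⊗f − k ∑_j (1/(j+1)!) (ad X)^j (∂̃ X)`,
i.e. `e^{ad X}(k∂ + Q − f⊗1) = k∂ + Q_can − f⊗1` in `ℂ∂ ⋉ (A ⊗ L)`;
the sums are finite because `ad X` is nilpotent. -/
theorem stmt_12 {L : Type*} [LieRing L] [LieAlgebra ℂ L] [FiniteDimensional ℂ L]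
    (e h f : L)
    (hhe : ⁅h, e⁆ = (2 : ℂ) • e) (hhf : ⁅h, f⁆ = (-2 : ℂ) • f) (hef : ⁅e, f⁆ = h)
    (Lg : ℤ → Submodule ℂ L)
    (hLg : ∀ j : ℤ, ∀ x ∈ Lg j, ⁅h, x⁆ = (j : ℂ) • x)
    (hinternal : DirectSum.IsInternal Lg)
    (hfinsupp : {j : ℤ | Lg j ≠ ⊥}.Finite)
    (n mperp : Submodule ℂ L)
    (hn : n = ⨆ j : {j : ℤ // 1 ≤ j}, Lg j)
    (hmperp : mperp = ⨆ j : {j : ℤ // -1 ≤ j}, Lg j)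
    (hinj : ∀ x ∈ n, ⁅f, x⁆ = 0 → x = 0)
    (Vf : Submodule ℂ L) (hVf_le : Vf ≤ mperp)
    (hVf_inv : ∀ x ∈ Vf, ⁅h, x⁆ ∈ Vf)
    (hsum : Submodule.map (LieAlgebra.ad ℂ L f) n ⊔ Vf = mperp)
    (hdisj : Submodule.map (LieAlgebra.ad ℂ L f) n ⊓ Vf = ⊥)
    {A : Type*} [CommRing A] [Algebra ℂ A]
    (Dr : Derivation ℂ A A) (k : ℂ) :
    ∀ Q ∈ Submodule.baseChange A mperp,
      ∃! XQ : (A ⊗[ℂ] L) × (A ⊗[ℂ] L),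
        XQ.1 ∈ Submodule.baseChange A n ∧
        XQ.2 ∈ Submodule.baseChange A Vf ∧
        ∃ N : ℕ, (∀ y : A ⊗[ℂ] L, (fun z => ⁅XQ.1, z⁆)^[N] y = 0) ∧
          XQ.2 = (∑ j ∈ Finset.range N, ((j.factorial : ℂ)⁻¹) •
                    (fun z => ⁅XQ.1, z⁆)^[j] (Q - (1 : A) ⊗ₜ[ℂ] f))
                 + (1 : A) ⊗ₜ[ℂ] f
                 - k • ∑ j ∈ Finset.range N, (((j + 1).factorial : ℂ)⁻¹) •
                    (fun z => ⁅XQ.1, z⁆)^[j]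
                      ((LinearMap.rTensor L Dr.toLinearMap) XQ.1) := by
    classical
  have heig : ∀ (j : ℤ) (y : L), ⁅h, y⁆ = (j : ℂ) • y → y ∈ Lg j :=
    fun j y hy => Gauge12.mem_of_eig h Lg hLg hinternal j y hy
  set G : ℤ → Submodule ℂ L := fun p => ⨆ j : {j : ℤ // p ≤ j}, Lg j with hG
  have hn' : n = G 1 := hn
  have hm' : mperp = G (-1) := hmperp
  have hLG : ∀ p j : ℤ, p ≤ j → Lg j ≤ G p := fun p j hpj =>
    le_iSup (fun j : {j : ℤ // p ≤ j} => Lg j) ⟨j, hpj⟩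
  have hGanti : ∀ p q : ℤ, p ≤ q → G q ≤ G p := by
    intro p q hpq
    exact iSup_le fun j => hLG p j (hpq.trans j.2)
  have hGle : ∀ (p : ℤ) (S : Submodule ℂ L), (∀ j, p ≤ j → Lg j ≤ S) → G p ≤ S :=
    fun p S hS => iSup_le fun j => hS j j.2
  have hgr : ∀ i j : ℤ, ∀ x ∈ Lg i, ∀ y ∈ Lg j, ⁅x, y⁆ ∈ Lg (i + j) := by
    intro i j x hx y hy
    apply heig
    rw [leibniz_lie, hLg i x hx, hLg j y hy, smul_lie, lie_smul, ← add_smul]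
    push_cast; rfl
  have hGbr : ∀ p q : ℤ, ∀ x ∈ G p, ∀ y ∈ G q, ⁅x, y⁆ ∈ G (p + q) := by
    intro p q x hx y hy
    have h1 : G p ≤ (G (p + q)).comap (LieAlgebra.ad ℂ L y) := by
      refine hGle p _ fun i hi x hx => ?_
      have h2 : G q ≤ (G (p + q)).comap (LieAlgebra.ad ℂ L x) := by
        refine hGle q _ fun j hj y hy => ?_
        exact hLG _ (i + j) (by omega) (hgr i j x hx y hy)
      have h3 : ⁅x, y⁆ ∈ G (p + q) := h2 hy
      have h4 := neg_mem h3
      rw [lie_skew] at h4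
      exact h4
    have h3 : ⁅y, x⁆ ∈ G (p + q) := h1 hx
    have h4 := neg_mem h3
    rw [lie_skew] at h4
    exact h4
  have hfm : f ∈ Lg (-2) := heig _ _ (by rw [hhf]; norm_num)
  obtain ⟨b, hb⟩ : ∃ b : ℕ, ∀ j : ℤ, Lg j ≠ ⊥ → -(b : ℤ) ≤ j ∧ j < b := by
    obtain ⟨B, hB⟩ := hfinsupp.bddAbove
    obtain ⟨C, hC⟩ := hfinsupp.bddBelow
    refine ⟨B.natAbs + C.natAbs + 1, fun j hj => ?_⟩
    have h1 : j ≤ B := hB hj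
    have h2 : C ≤ j := hC hj
    constructor <;> omega
  have hGtop : G (-b) = ⊤ := by
    rw [eq_top_iff, ← hinternal.submodule_iSup_eq_top]
    refine iSup_le fun j => ?_
    by_cases hj : Lg j = ⊥
    · rw [hj]; exact bot_le
    · exact hLG _ _ (hb j hj).1
  have hGbot : G b = ⊥ := by
    rw [eq_bot_iff]
    refine hGle _ _ fun j hj => ?_
    by_contra hc
    have := (hb j (fun h0 => hc (by rw [h0]))).2
    omega
  -- the splitting
  let U : (n × Vf) →ₗ[ℂ] L :=
    ((LieAlgebra.ad ℂ L f).comp n.subtype).coprod Vf.subtype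
  have hU : ∀ x v, U (x, v) = ⁅f, (x : L)⁆ + v := fun x v => rfl
  have hUinj : Function.Injective U := by
    rw [← LinearMap.ker_eq_bot, LinearMap.ker_eq_bot']
    rintro ⟨x, v⟩ hxv
    rw [hU] at hxv
    have h1 : (v : L) ∈ Submodule.map (LieAlgebra.ad ℂ L f) n ⊓ Vf := by
      refine ⟨⟨-x, neg_mem x.2, ?_⟩, v.2⟩
      rw [map_neg]
      exact neg_eq_of_add_eq_zero_right hxv
    rw [hdisj] at h1
    have hv : (v : L) = 0 := by simpa using h1
    rw [hv, add_zero] at hxv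
    have hx := hinj x x.2 hxv
    ext
    · simpa using hx
    · simpa using hv
  obtain ⟨W, hW⟩ := U.exists_leftInverse_of_injective (LinearMap.ker_eq_bot.2 hUinj)
  have hW' : ∀ x v, W (U (x, v)) = (x, v) := fun x v => LinearMap.congr_fun hW (x, v)
  let T : L →ₗ[ℂ] L := (n.subtype.comp (LinearMap.fst ℂ n Vf)).comp W
  have hTU : ∀ x ∈ n, ∀ v ∈ Vf, T (⁅f, x⁆ + v) = x := by
    intro x hx v hv
    have := hW' ⟨x, hx⟩ ⟨v, hv⟩
    rw [hU] at this
    simp only at this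
    simp [T, this]
  have hdec : ∀ y ∈ mperp, ∃ x ∈ n, ∃ v ∈ Vf, ⁅f, x⁆ + v = y := by
    intro y hy
    rw [← hsum, Submodule.mem_sup] at hy
    obtain ⟨_, ⟨x, hx, rfl⟩, v, hv, rfl⟩ := hy
    exact ⟨x, hx, v, hv, rfl⟩
  have hhn : ∀ x ∈ n, ⁅h, x⁆ ∈ n := by
    have h0 : h ∈ G 0 := hLG 0 0 le_rfl (heig _ _ (by simp))
    intro x hx
    rw [hn'] at hx ⊢
    simpa using hGbr 0 1 h h0 x hx
  have hTgr : ∀ j : ℤ, -1 ≤ j → ∀ y ∈ Lg j, T y ∈ Lg (j + 2) := by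
    intro j hj y hy
    obtain ⟨x, hx, v, hv, hxv⟩ := hdec y (by rw [hm']; exact hLG _ _ hj hy)
    have e1 : T ⁅h, y⁆ = ⁅h, x⁆ - (2 : ℂ) • x := by
      have : ⁅h, y⁆ = ⁅f, ⁅h, x⁆ - (2 : ℂ) • x⁆ + ⁅h, v⁆ := by
        rw [← hxv, lie_add, leibniz_lie, hhf, lie_sub, smul_lie, lie_smul, neg_smul]
        abel
      rw [this]
      exact hTU _ (sub_mem (hhn x hx) (n.smul_mem _ hx)) _ (hVf_inv v hv)
    have e2 : T y = x := by rw [← hxv]; exact hTU x hx v hv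
    rw [hLg j y hy, map_smul, e2] at e1
    rw [e2]
    apply heig
    rw [← sub_add_cancel ⁅h, x⁆ ((2 : ℂ) • x), ← e1, ← add_smul]
    push_cast; rfl
  have hTG : ∀ q : ℤ, -1 ≤ q → ∀ y ∈ G q, T y ∈ G (q + 2) := by
    intro q hq y hy
    have : G q ≤ (G (q + 2)).comap T := by
      refine hGle _ _ fun j hj y hy => ?_
      exact hLG _ (j + 2) (by omega) (hTgr j (by omega) y hy)
    exact this hy
  intro Q hQ
  rw [hm'] at hQ
  have key := Gauge12.bridge G hGanti hGbr b hGtop hGbot f (hLG _ _ le_rfl hfm) T Vf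
    (fun x hx v hv => hTU x (hn' ▸ hx) v hv) (fun y hy => by
      obtain ⟨x, hx, v, hv, hxv⟩ := hdec y (hm' ▸ hy)
      exact ⟨x, hn' ▸ hx, v, hv, hxv⟩) hTG Dr k Q hQ
  rw [hn']
  exact key
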